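/- arXiv:2302.04718 — 3 statements merged into one kernel-verified Lean document; each statement's English description precedes it below -/
import Mathlib

section
/- The number of hyperovals in PG(2,4) is exactly 168. -/
open Submodule

/-- The points of the projective space `PG(n, K)`: the 1-dimensional
`K`-subspaces of `K^{n+1}`. -/
def PGPoint (K : Type*) [Field K] (n : ℕ) : Type _ :=
  {W : Submodule K (Fin (n + 1) → K) // Module.finrank K W = 1}

/-- The set of points of `PG(n, K)` lying in a given linear subspace. -/
def pts {K : Type*} [Field K] {n : ℕ} (W : Submodule K (Fin (n + 1) → K)) :
    Set (PGPoint K n) :=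
  {P | P.1 ≤ W}

/-- `S` is a `k`-dimensional projective subspace of `PG(n, K)`. -/
def IsKSpace {K : Type*} [Field K] {n : ℕ} (k : ℕ) (S : Set (PGPoint K n)) : Prop :=
  ∃ W : Submodule K (Fin (n + 1) → K), Module.finrank K W = k + 1 ∧ S = pts W

/-- A set of points is of even type if every line meets it in an even
number of points. -/
def IsEvenType {K : Type*} [Field K] {n : ℕ} (S : Set (PGPoint K n)) : Prop :=
  ∀ L : Set (PGPoint K n), IsKSpace 1 L → Even (S ∩ L).ncard

/-- `O` is a hyperoval in the plane `π`: a set of `q + 2` points of `π`,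
no three of which are collinear. -/
def IsHyperovalIn {K : Type*} [Field K] {n : ℕ}
    (π O : Set (PGPoint K n)) : Prop :=
  O ⊆ π ∧ O.ncard = Nat.card K + 2 ∧
    ∀ L : Set (PGPoint K n), IsKSpace 1 L → (O ∩ L).ncard ≤ 2

/-- A hypercylinder in `PG(n, K)`, `n ≥ 3`: the set
`(⋃_{P ∈ O} ⟨P, τ⟩) \ τ`, where `O` is a hyperoval in a plane `π` and the
vertex `τ` is an `(n-3)`-dimensional projective subspace (linear dimension
`n - 2`) disjoint from `π`.  (For `n = 3` the vertex is a point.) -/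
def IsHypercylinder {K : Type*} [Field K] {n : ℕ}
    (S : Set (PGPoint K n)) : Prop :=
  ∃ (Wπ T : Submodule K (Fin (n + 1) → K)) (O : Set (PGPoint K n)),
    Module.finrank K Wπ = 3 ∧ Module.finrank K T = n - 2 ∧ Wπ ⊓ T = ⊥ ∧
    IsHyperovalIn (pts Wπ) O ∧
    S = {Q : PGPoint K n | (∃ P ∈ O, Q.1 ≤ P.1 ⊔ T) ∧ ¬ Q.1 ≤ T}

namespace HO

/-- Incidence table of the 21 points and 21 lines, as a bit mask. -/
def M : ℕ := 189281089038996197039222210811074444015977896194130294796281747093685540932277847999097674660039923088888450458385015832930844344320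

/-- Table of collinear triples of distinct points, as a bit mask. -/
def T : ℕ := 7196284463003202157784013227435719942757250280099848799881661041240731304426498955562464161475287996973243110867688473282953149894309906604097033579514681052032511210626324365544053213836893237177116422110696635960863080263985997808574885268788809562728326955486857305592936564578304097861559530895166717448154199177549933235720491004712862253685487264096517250525035316570571620951325152229704221186962685863865275659671725760622987072861967838173721398660804701334686758719720009581874742378430432737407722462539707287768276885296518713531953306913892053830268187641608788658241470137576811977032727444428025783401032182075540277662353522638561670633276810224224658249068117399342385662617631566736798484761268000373301281727811649702690279760622595032344229870754876354944852281170426293460384896885523825465226574238882043992768339201930394236150230056935205225312624395558240266519168202843797313519640998537559706806285268448970511893225952205510209522912821855882179359237409355313636126187660935916503171548042960896396109773890564694075100733173111178044602405468508656890253309669702423112797909469527205313669843753649175236135524106388446157958829549586406446243276361491871432998360919592186810480907157846783801620025763713637638839844430577613484692430766924092693494204113775854653696987713698619676778149021716242880622981502271188006921308890407574374823939592781669621679744617175134565901142424651170135570396418785955993181588982197905058317771164174710019553443687680394562112251481400374470685501162838744270825937807220315396293352284040580516591878578756220689394016101004288362709076719373226516606614497902466538101082449287395467450499691720261612494861783229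94310458177839091338604602113749339993614458963606851231849642641314508567731925935684367777799491563416749715555178880260175991870758062157117481565030400274943350864949188200038098481395131515520724517947743572302642153326442205299126929724704092936016738398434033791089680766039070039910496754662649871832181476488342256557025127627714132617724540803853465940732976123683562062721445765546611916070204695291449408116516468880189331025015266702120065092916173844247447900325241469722022309054098884158104736666275409486004483042301789316188782093722972514990858055741526199653423312963448093066021302977268814596533246921340432875318329916587219541281992350932176435301489260751111936276809427303802051422824677222156039795464176056913359692222007128511995288625665064325936960402326397550614909079019834234662856076616966824435237785174968673586278160758235342753828835856289308142234080783398040663983819716463927706848857280674984216084450588157222471385752026129715958466305707521669741532527143554906894011535046911663898450090395313887914307248189522516225713357788046320584024349736960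

def inc (i j : Fin 21) : Bool := Nat.testBit M (i.1 * 21 + j.1)

def coll (a b c : Fin 21) : Bool := Nat.testBit T (a.1 * 441 + b.1 * 21 + c.1)

theorem coll_diag : ∀ a c : Fin 21, coll a a c = false := by
  decide +kernel

theorem coll_line : ∀ a b : Fin 21, a ≠ b → ∃ j, (inc a j = true ∧ inc b j = true) ∧
    (∀ k, inc a k = true → inc b k = true → k = j) ∧
    ∀ c, coll a b c = true ↔ (inc c j = true ∧ a ≠ c ∧ b ≠ c) := by
  decide +kernel

theorem coll_spec (a b c : Fin 21) : coll a b c = true ↔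
    (a ≠ b ∧ a ≠ c ∧ b ≠ c ∧ ∃ j, inc a j = true ∧ inc b j = true ∧ inc c j = true) := by
  by_cases hab : a = b
  · subst hab
    simp [coll_diag]
  · obtain ⟨j, ⟨ha, hb⟩, hu, hc⟩ := coll_line a b hab
    rw [hc]
    constructor
    · rintro ⟨h1, h2, h3⟩
      exact ⟨hab, h2, h3, j, ha, hb, h1⟩
    · rintro ⟨-, h2, h3, k, ka, kb, kc⟩
      exact ⟨hu k ka kb ▸ kc, h2, h3⟩

theorem coll_swap (a b c : Fin 21) : coll a b c = true ↔ coll b a c = true := by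
  rw [coll_spec, coll_spec]; grind

theorem coll_rot (a b c : Fin 21) : coll a b c = true ↔ coll b c a = true := by
  rw [coll_spec, coll_spec]; grind

def compat (a : Fin 21) (acc : List (Fin 21)) : Bool :=
  acc.all fun b => acc.all fun c => !coll a b c

def arc (l : List (Fin 21)) : Prop := ∀ a ∈ l, ∀ b ∈ l, ∀ c ∈ l, coll a b c = false

theorem coll_self (a b c : Fin 21) (h : a = b ∨ a = c ∨ b = c) : coll a b c = false := by
  rw [← Bool.not_eq_true, coll_spec]; grind

theorem arc_cons (a : Fin 21) (l : List (Fin 21)) :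
    arc (a :: l) ↔ (compat a l = true ∧ arc l) := by
  have hc : compat a l = true ↔ ∀ b ∈ l, ∀ c ∈ l, coll a b c = false := by
    simp [compat]
  rw [hc]
  constructor
  · intro h
    exact ⟨fun b hb c hc => h a (by simp) b (by simp [hb]) c (by simp [hc]),
      fun x hx b hb c hc => h x (by simp [hx]) b (by simp [hb]) c (by simp [hc])⟩
  · rintro ⟨h1, h2⟩ x hx y hy z hz
    rw [List.mem_cons] at hx hy hz
    rcases hx with rfl | hx <;> rcases hy with rfl | hy <;> rcases hz with rfl | hz
    · exact coll_self _ _ _ (by simp)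
    · exact coll_self _ _ _ (by simp)
    · exact coll_self _ _ _ (by simp)
    · exact h1 _ hy _ hz
    · exact coll_self _ _ _ (by simp)
    · rw [← Bool.not_eq_true, coll_swap, Bool.not_eq_true]; exact h1 _ hx _ hz
    · rw [← Bool.not_eq_true, ← coll_rot, Bool.not_eq_true]; exact h1 _ hx _ hy
    · exact h2 _ hx _ hy _ hz

/-- Depth first count of the arcs of size 6 extending `acc` by points of the list. -/
def cnt : List (Fin 21) → List (Fin 21) → ℕ
  | [], acc => cond (Nat.beq acc.length 6) 1 0
  | a :: l, acc => cnt l acc + cond (compat a acc) (cnt l (a :: acc)) 0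

def gd : List (Fin 21) → List (Fin 21) → Bool
  | [], acc => Nat.beq acc.length 6
  | a :: s, acc => compat a acc && gd s (a :: acc)

theorem cnt_eq (l : List (Fin 21)) : ∀ acc,
    cnt l acc = ((List.sublists' l).filter (fun s => gd s acc)).length := by
  induction l with
  | nil =>
    intro acc
    by_cases h : Nat.beq acc.length 6 = true <;> simp [cnt, gd, h]
  | cons a l ih =>
    intro acc
    rw [cnt, List.sublists'_cons, List.filter_append, List.length_append, ← ih, List.filter_map,
      List.length_map]
    congr 1
    by_cases h : compat a acc = true
    · rw [h, cond_true, ih]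
      congr 2
      funext s
      simp [gd, h]
    · rw [Bool.not_eq_true] at h
      rw [h, cond_false]
      simp [Function.comp_def, gd, h]

theorem gd_iff (s : List (Fin 21)) : ∀ acc, arc acc →
    (gd s acc = true ↔ (s.length + acc.length = 6 ∧ arc (s.reverse ++ acc))) := by
  induction s with
  | nil => intro acc h; simp [gd, h]
  | cons a s ih =>
    intro acc h
    rw [gd, Bool.and_eq_true]
    have e : (a :: s).reverse ++ acc = s.reverse ++ (a :: acc) := by simp
    rw [e]
    have l : (a :: s).length + acc.length = s.length + (a :: acc).length := by simp; omega
    rw [l]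
    constructor
    · rintro ⟨h1, h2⟩
      exact (ih _ ((arc_cons _ _).2 ⟨h1, h⟩)).1 h2
    · rintro ⟨h1, h2⟩
      have h3 : arc (a :: acc) := fun x hx y hy z hz =>
        h2 x (List.mem_append_right _ hx) y (List.mem_append_right _ hy) z
          (List.mem_append_right _ hz)
      exact ⟨((arc_cons _ _).1 h3).1, (ih _ h3).2 ⟨h1, h2⟩⟩

def allPts : List (Fin 21) := [⟨0, by decide⟩, ⟨1, by decide⟩, ⟨2, by decide⟩, ⟨3, by decide⟩,
  ⟨4, by decide⟩, ⟨5, by decide⟩, ⟨6, by decide⟩, ⟨7, by decide⟩, ⟨8, by decide⟩, ⟨9, by decide⟩,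
  ⟨10, by decide⟩, ⟨11, by decide⟩, ⟨12, by decide⟩, ⟨13, by decide⟩, ⟨14, by decide⟩,
  ⟨15, by decide⟩, ⟨16, by decide⟩, ⟨17, by decide⟩, ⟨18, by decide⟩, ⟨19, by decide⟩,
  ⟨20, by decide⟩]

theorem allPts_eq : allPts = List.finRange 21 := by decide

theorem cnt_val : cnt allPts [] = 168 := by decide +kernel

def good (s : Finset (Fin 21)) : Prop :=
  s.card = 6 ∧ ∀ j, (s.filter (fun i => inc i j = true)).card ≤ 2

theorem good_iff (l : List (Fin 21)) (hl : l.Nodup) :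
    good l.toFinset ↔ gd l [] = true := by
  rw [gd_iff _ _ (by simp [arc])]
  have : l.toFinset.card = l.length := List.toFinset_card_of_nodup hl
  rw [good, this]
  simp only [List.length_nil, add_zero, List.append_nil]
  refine and_congr_right fun _ => ?_
  constructor
  · intro h a ha b hb c hc
    rw [← Bool.not_eq_true, coll_spec]
    rintro ⟨h1, h2, h3, j, ja, jb, jc⟩
    have := h j
    rw [← not_lt, Finset.two_lt_card] at this
    apply this
    refine ⟨a, ?_, b, ?_, c, ?_, h1, h2, h3⟩
    · simp at ha; simp [ha, ja]
    · simp at hb; simp [hb, jb]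
    · simp at hc; simp [hc, jc]
  · intro h j
    rw [← not_lt, Finset.two_lt_card]
    rintro ⟨a, ha, b, hb, c, hc, h1, h2, h3⟩
    simp at ha hb hc
    have := h a (by simp [ha.1]) b (by simp [hb.1]) c (by simp [hc.1])
    rw [← Bool.not_eq_true, coll_spec] at this
    exact this ⟨h1, h2, h3, j, ha.2, hb.2, hc.2⟩

theorem good_card : {s : Finset (Fin 21) | good s}.ncard = 168 := by
  classical
  rw [← cnt_val, cnt_eq, allPts_eq]
  have hnd : (List.finRange 21).Nodup := List.nodup_finRange 21
  set L := (List.sublists' (List.finRange 21)).filter (fun s => gd s []) with hL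
  have hLn : L.Nodup := (List.nodup_sublists'.2 hnd).filter _
  have hsub : ∀ l ∈ L, l.Sublist (List.finRange 21) := fun l hl =>
    List.mem_sublists'.1 (List.mem_filter.1 hl).1
  have himg : {s : Finset (Fin 21) | good s} = List.toFinset '' (L.toFinset : Set (List (Fin 21))) := by
    ext s
    simp only [Set.mem_ofPred_eq, Set.mem_image, List.coe_toFinset]
    constructor
    · intro h
      have hd : ((List.finRange 21).filter (fun i => decide (i ∈ s))).Nodup := hnd.filter _
      have hs : ((List.finRange 21).filter (fun i => decide (i ∈ s))).toFinset = s := by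
        ext x; simp
      refine ⟨(List.finRange 21).filter (fun i => decide (i ∈ s)), ?_, ?_⟩
      · rw [hL, List.mem_filter]
        refine ⟨List.mem_sublists'.2 List.filter_sublist, ?_⟩
        exact (good_iff _ hd).1 (hs.symm ▸ h)
      · ext x; simp
    · rintro ⟨l, hl, rfl⟩
      have hd := (hsub l hl).nodup hnd
      exact (good_iff l hd).2 (List.mem_filter.1 hl).2
  rw [himg, Set.InjOn.ncard_image, Set.ncard_coe_finset, List.toFinset_card_of_nodup hLn]
  intro l hl l' hl' h
  simp only [List.coe_toFinset, Set.mem_ofPred_eq] at hl hl'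
  have s1 := hsub l hl
  have s2 := hsub l' hl'
  have hp : l.Perm l' := by
    rw [List.perm_ext_iff_of_nodup (s1.nodup hnd) (s2.nodup hnd)]
    intro a
    rw [← List.mem_toFinset, ← List.mem_toFinset (l := l')]
    exact h ▸ Iff.rfl
  have hsort : (List.finRange 21).Pairwise (· < ·) := List.pairwise_lt_finRange 21
  exact hp.eq_of_pairwise (fun a b _ _ h1 h2 => absurd h1 (lt_asymm h2))
    (hsort.sublist s1) (hsort.sublist s2)

/-! ### The field with four elements -/

abbrev K := GaloisField 2 2

theorem card_K : Nat.card K = 4 := by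
  have := GaloisField.card 2 2 (by norm_num)
  simpa using this

theorem exists_omega : ∃ x : K, x * x = x + 1 := by
  classical
  have : Fintype K := Fintype.ofFinite K
  have hc : Fintype.card K = 4 := by rw [← Nat.card_eq_fintype_card, card_K]
  have : ∃ x : K, x ∉ ({0, 1} : Finset K) := by
    by_contra! h
    have h1 : Finset.univ ⊆ ({0, 1} : Finset K) := fun x _ => h x
    have h2 := Finset.card_le_card h1
    rw [Finset.card_univ, hc] at h2
    have := Finset.card_le_two (a := (0 : K)) (b := 1)
    omega
  obtain ⟨x, hx⟩ := this
  simp only [Finset.mem_insert, Finset.mem_singleton, not_or] at hx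
  have h4 : x ^ 4 = x := by rw [← hc]; exact FiniteField.pow_card x
  have h2 : (2 : K) = 0 := CharTwo.two_eq_zero
  refine ⟨x, ?_⟩
  have h : x * ((x - 1) * (x * x + x + 1)) = 0 := by linear_combination h4
  have h' : x * x + x + 1 = 0 := by
    rcases mul_eq_zero.1 h with h | h
    · exact absurd h hx.1
    · rcases mul_eq_zero.1 h with h | h
      · exact absurd (sub_eq_zero.1 h) hx.2
      · exact h
  linear_combination h' - (x + 1) * h2

noncomputable def om : K := exists_omega.choose
theorem om_sq : om * om = om + 1 := exists_omega.choose_spec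

noncomputable def c (a : Fin 4) : K := ![0, 1, om, om + 1] a

def mul4 (a b : Fin 4) : Fin 4 := if a = 0 ∨ b = 0 then 0 else
  ⟨1 + (a.1 + b.1 - 2) % 3, by omega⟩

def add4 (a b : Fin 4) : Fin 4 := a ^^^ b

theorem c_mul : ∀ a b, c (mul4 a b) = c a * c b := by
  have h2 : (2 : K) = 0 := CharTwo.two_eq_zero
  have h := om_sq
  intro a b
  fin_cases a <;> fin_cases b <;> simp [c, mul4] <;> grind

theorem c_add : ∀ a b, c (add4 a b) = c a + c b := by
  have h2 : (2 : K) = 0 := CharTwo.two_eq_zero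
  have e : ∀ a b : Fin 4, add4 a b = ![![0,1,2,3],![1,0,3,2],![2,3,0,1],![3,2,1,0]] a b := by
    decide
  intro a b
  rw [e]
  fin_cases a <;> fin_cases b <;> simp [c] <;> grind

theorem c_zero : c 0 = 0 := rfl
theorem c_one : c 1 = 1 := rfl

theorem c_eq_zero (a : Fin 4) : c a = 0 ↔ a = 0 := by
  constructor
  · intro h
    by_contra ha
    have : ∀ a : Fin 4, a ≠ 0 → ∃ b, mul4 a b = 1 := by decide
    obtain ⟨b, hb⟩ := this a ha
    have h3 := c_mul a b
    rw [hb, h, zero_mul, c_one] at h3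
    exact one_ne_zero h3
  · rintro rfl; rfl

theorem c_inj : Function.Injective c := by
  intro a b h
  have h1 : c (add4 a b) = 0 := by rw [c_add, h, CharTwo.add_self_eq_zero]
  rw [c_eq_zero] at h1
  clear h
  revert a b
  decide

theorem c_surj : Function.Surjective c := by
  have : Function.Bijective c := by
    rw [Nat.bijective_iff_injective_and_card]
    exact ⟨c_inj, by rw [card_K]; simp⟩
  exact this.2

/-! ### Coordinates -/

def w (i : Fin 21) : Fin 3 → Fin 4 :=
  if i.1 < 16 then ![1, ⟨i.1 / 4 % 4, by omega⟩, ⟨i.1 % 4, by omega⟩]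
  else if i.1 < 20 then ![0, 1, ⟨i.1 % 4, by omega⟩] else ![0, 0, 1]

theorem w_ne : ∀ i, w i 0 ≠ 0 ∨ w i 1 ≠ 0 ∨ w i 2 ≠ 0 := by decide +kernel

theorem w_inj : ∀ i j t, w i 0 = mul4 t (w j 0) → w i 1 = mul4 t (w j 1) →
    w i 2 = mul4 t (w j 2) → i = j := by decide +kernel

theorem w_surj : ∀ x y z : Fin 4, (x ≠ 0 ∨ y ≠ 0 ∨ z ≠ 0) → ∃ i t, t ≠ 0 ∧
    x = mul4 t (w i 0) ∧ y = mul4 t (w i 1) ∧ z = mul4 t (w i 2) := by decide +kernel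

theorem w_inc : ∀ i j, inc i j = true ↔ add4 (add4 (mul4 (w j 0) (w i 0)) (mul4 (w j 1) (w i 1)))
    (mul4 (w j 2) (w i 2)) = 0 := by decide +kernel

noncomputable def v (i : Fin 21) : Fin (2 + 1) → K := fun k => c (w i k)

theorem v_ne (i : Fin 21) : v i ≠ 0 := by
  intro h
  have e : ∀ k, w i k = 0 := fun k => (c_eq_zero _).1 (congrFun h k)
  rcases w_ne i with h | h | h <;> exact h (e _)

theorem v_surj (x : Fin (2 + 1) → K) (hx : x ≠ 0) : ∃ i, ∃ t : K, t ≠ 0 ∧ x = t • v i := by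
  choose y hy using fun k => c_surj (x k)
  have h : y 0 ≠ 0 ∨ y 1 ≠ 0 ∨ y 2 ≠ 0 := by
    by_contra! h
    apply hx
    funext k
    rw [← hy k]
    fin_cases k
    · exact (c_eq_zero _).2 h.1
    · exact (c_eq_zero _).2 h.2.1
    · exact (c_eq_zero _).2 h.2.2
  obtain ⟨i, t, ht, h0, h1, h2⟩ := w_surj _ _ _ h
  refine ⟨i, c t, fun h => ht ((c_eq_zero _).1 h), ?_⟩
  funext k
  rw [Pi.smul_apply, smul_eq_mul, v, ← c_mul, ← hy k]
  congr 1
  fin_cases k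
  · exact h0
  · exact h1
  · exact h2

theorem v_inj (i j : Fin 21) (t : K) (h : v i = t • v j) : i = j := by
  obtain ⟨t, rfl⟩ := c_surj t
  have e : ∀ k, w i k = mul4 t (w j k) := fun k => c_inj (by
    rw [c_mul]; exact congrFun h k)
  exact w_inj i j t (e 0) (e 1) (e 2)

noncomputable def pt (i : Fin 21) : PGPoint K 2 :=
  ⟨K ∙ v i, finrank_span_singleton (v_ne i)⟩

theorem pt_inj : Function.Injective pt := by
  intro i j h
  have h1 : (K ∙ v i) = K ∙ v j := congrArg Subtype.val h
  have h2 : v i ∈ K ∙ v j := h1 ▸ mem_span_singleton_self _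
  obtain ⟨t, ht⟩ := mem_span_singleton.1 h2
  exact v_inj i j t ht.symm

theorem pt_surj : Function.Surjective pt := by
  rintro ⟨W, hW⟩
  obtain ⟨⟨x, hxW⟩, hx, hs⟩ := finrank_eq_one_iff'.1 hW
  have hx0 : x ≠ 0 := fun h => hx (by ext1; exact h)
  obtain ⟨i, t, ht, rfl⟩ := v_surj x hx0
  refine ⟨i, Subtype.ext ?_⟩
  change (K ∙ v i) = W
  have hv : v i ∈ W := by
    have := W.smul_mem t⁻¹ hxW
    rwa [smul_smul, inv_mul_cancel₀ ht, one_smul] at this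
  apply le_antisymm
  · rwa [span_singleton_le_iff_mem]
  · intro y hy
    obtain ⟨d, hd⟩ := hs ⟨y, hy⟩
    have hd' : d • (t • v i) = y := congrArg Subtype.val hd
    rw [← hd', smul_smul]
    exact smul_mem _ _ (mem_span_singleton_self _)

noncomputable def lin (j : Fin 21) : (Fin (2 + 1) → K) →ₗ[K] K := Fintype.linearCombination K (v j)

theorem lin_apply (j : Fin 21) (x : Fin (2 + 1) → K) :
    lin j x = v j 0 * x 0 + v j 1 * x 1 + v j 2 * x 2 := by
  simp [lin, Fintype.linearCombination_apply, Fin.sum_univ_three, mul_comm]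

theorem lin_v (i j : Fin 21) : lin j (v i) = 0 ↔ inc i j = true := by
  rw [lin_apply, w_inc, ← c_eq_zero, c_add, c_add, c_mul, c_mul, c_mul]
  rfl

theorem finrank_ker (f : (Fin (2 + 1) → K) →ₗ[K] K) (hf : f ≠ 0) :
    Module.finrank K (LinearMap.ker f) = 2 := by
  have h1 := f.finrank_range_add_finrank_ker
  rw [LinearMap.range_eq_top.2 (LinearMap.surjective hf), finrank_top, Module.finrank_self,
    Module.finrank_fin_fun] at h1
  omega

theorem lin_ne (j : Fin 21) : lin j ≠ 0 := by
  intro h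
  apply v_ne j
  funext k
  have := congrArg (fun f => f (Pi.single k 1)) h
  simpa [lin, Fintype.linearCombination_apply, Pi.single_apply] using this

theorem line_iff (L : Set (PGPoint K 2)) :
    IsKSpace 1 L ↔ ∃ j, L = pts (LinearMap.ker (lin j)) := by
  constructor
  · rintro ⟨W, hW, rfl⟩
    have hlt : W < ⊤ := by
      rw [lt_top_iff_ne_top]
      rintro rfl
      rw [finrank_top, Module.finrank_fin_fun] at hW
      omega
    obtain ⟨f, hf, hle⟩ := W.exists_le_ker_of_lt_top hlt
    have hWf : W = LinearMap.ker f := by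
      apply Submodule.eq_of_le_of_finrank_eq hle
      rw [hW, finrank_ker f hf]
    have hfx : ∀ x, f x = ∑ k, x k * f (Pi.single k 1) := by
      intro x
      conv_lhs => rw [pi_eq_sum_univ' x]
      simp [Pi.single]
    have hne : (fun k => f (Pi.single k 1)) ≠ 0 := by
      intro h
      apply hf
      ext1 k
      ext
      simpa using congrFun h k
    obtain ⟨j, t, ht, hj⟩ := v_surj _ hne
    refine ⟨j, ?_⟩
    rw [hWf]
    congr 1
    ext x
    rw [LinearMap.mem_ker, LinearMap.mem_ker, hfx]
    have : ∑ k, x k * f (Pi.single k 1) = t * lin j x := by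
      simp only [lin, Fintype.linearCombination_apply, Finset.mul_sum, smul_eq_mul]
      refine Finset.sum_congr rfl fun k _ => ?_
      rw [show f (Pi.single k 1) = t * v j k from congrFun hj k]
      ring
    rw [this, mul_eq_zero, or_iff_right ht]
  · rintro ⟨j, rfl⟩
    exact ⟨_, finrank_ker _ (lin_ne j), rfl⟩

theorem pt_mem (i j : Fin 21) : pt i ∈ pts (LinearMap.ker (lin j)) ↔ inc i j = true := by
  rw [← lin_v]
  change (K ∙ v i) ≤ _ ↔ _
  rw [span_singleton_le_iff_mem, LinearMap.mem_ker]

theorem good_image (s : Finset (Fin 21)) :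
    ((pt '' (s : Set (Fin 21))).ncard = Nat.card K + 2 ∧ ∀ L, IsKSpace 1 L →
      (pt '' (s : Set (Fin 21)) ∩ L).ncard ≤ 2) ↔ good s := by
  rw [Set.ncard_image_of_injective _ pt_inj, Set.ncard_coe_finset, card_K, good]
  refine and_congr_right fun _ => ?_
  have key : ∀ j, (pt '' (s : Set (Fin 21)) ∩ pts (LinearMap.ker (lin j))).ncard =
      (s.filter (fun i => inc i j = true)).card := by
    intro j
    rw [← Set.ncard_coe_finset, ← Set.ncard_image_of_injective _ pt_inj]
    congr 1
    ext P
    obtain ⟨i, rfl⟩ := pt_surj P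
    simp [pt_inj.eq_iff, pt_mem]
  constructor
  · intro h j
    rw [← key]
    exact h _ ((line_iff _).2 ⟨j, rfl⟩)
  · intro h L hL
    obtain ⟨j, rfl⟩ := (line_iff _).1 hL
    rw [key]
    exact h j

end HO

/-- The number of hyperovals in `PG(2,4)` (sets of `q + 2`
points, no three collinear, where `q = 4`) is exactly `168`.  (`PG(2,4)` is
built over the field `GaloisField 2 2` of `4` elements.) -/
theorem stmt15 :
    {O : Set (PGPoint (GaloisField 2 2) 2) |
      O.ncard = Nat.card (GaloisField 2 2) + 2 ∧
      ∀ L : Set (PGPoint (GaloisField 2 2) 2), IsKSpace 1 L →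
        (O ∩ L).ncard ≤ 2}.ncard = 168 := by
  classical
  rw [← HO.good_card]
  have hinj : Function.Injective (fun s : Finset (Fin 21) => HO.pt '' (s : Set (Fin 21))) := by
    intro s t h
    exact Finset.coe_injective (HO.pt_inj.image_injective h)
  rw [← Set.ncard_image_of_injective _ hinj]
  congr 1
  ext O
  have hO : ∃ s : Finset (Fin 21), O = HO.pt '' (s : Set (Fin 21)) := by
    refine ⟨(HO.pt ⁻¹' O).toFinset, ?_⟩
    rw [Set.coe_toFinset, Set.image_preimage_eq _ HO.pt_surj]
  obtain ⟨s, rfl⟩ := hO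
  rw [Function.Injective.mem_set_image hinj (a := s)]
  exact HO.good_image s
end

section
/- The number of hyperovals in PG(2,8) is exactly 32704. -/
open Submodule

/-- o-functions: the affine parts of hyperovals through the two standard points at infinity. -/
def OFun {K : Type*} [Field K] (f : K → K) : Prop :=
  Function.Injective f ∧ ∀ x y z, x ≠ y → x ≠ z → y ≠ z →
    (y - x) * (f z - f x) ≠ (z - x) * (f y - f x)

/-- The field with eight elements, coded by bit patterns. -/
def F8 : Type := Fin 8

namespace F8
instance : DecidableEq F8 := inferInstanceAs (DecidableEq (Fin 8))
instance : Fintype F8 := inferInstanceAs (Fintype (Fin 8))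

def ofN (n : ℕ) : F8 := (⟨n % 8, Nat.mod_lt _ (by norm_num)⟩ : Fin 8)
def toN (a : F8) : ℕ := Fin.val a
def addN (a b : ℕ) : ℕ := Nat.xor a b
def mulN (a b : ℕ) : ℕ := Nat.mod (Nat.shiftRight 2821848294356612419217921029917578219971947684264937521152 (3 * (8 * a + b))) 8
def invN (a : ℕ) : ℕ := Nat.mod (Nat.shiftRight 9272648 (3 * a)) 8

instance : Zero F8 := ⟨ofN 0⟩
instance : One F8 := ⟨ofN 1⟩
instance : Add F8 := ⟨fun a b => ofN (addN a.toN b.toN)⟩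
instance : Neg F8 := ⟨fun a => a⟩
instance : Mul F8 := ⟨fun a b => ofN (mulN a.toN b.toN)⟩
instance : Inv F8 := ⟨fun a => ofN (invN a.toN)⟩

instance : Field F8 where
  add_assoc := by decide +kernel
  zero_add := by decide +kernel
  add_zero := by decide +kernel
  add_comm := by decide +kernel
  neg_add_cancel := by decide +kernel
  mul_assoc := by decide +kernel
  one_mul := by decide +kernel
  mul_one := by decide +kernel
  zero_mul := by decide +kernel
  mul_zero := by decide +kernel
  mul_comm := by decide +kernel
  left_distrib := by decide +kernel
  right_distrib := by decide +kernel
  exists_pair_ne := by decide +kernel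
  mul_inv_cancel := by decide +kernel
  inv_zero := by decide +kernel
  nsmul := nsmulRec
  zsmul := zsmulRec
  nnqsmul := _
  qsmul := _

/-- slope of the segment joining two points of the affine plane -/
def slope (p r : F8 × F8) : F8 := (p.2 + r.2) * (p.1 + r.1)⁻¹

def slopeN (p r : F8 × F8) : ℕ :=
  mulN (addN p.2.toN r.2.toN) (invN (addN p.1.toN r.1.toN))

theorem slopeN_eq : ∀ p r, slopeN p r = (slope p r).toN := by
  rintro ⟨a, b⟩ ⟨c, d⟩
  revert a b c d
  decide +kernel

def nd : List ℕ → Bool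
  | [] => true
  | a :: l => !(l.any (Nat.beq a)) && nd l

theorem nd_iff (l : List ℕ) : nd l = true ↔ l.Nodup := by
  induction l with
  | nil => simp [nd]
  | cons a l ih =>
    simp only [nd, Bool.and_eq_true, ih, List.nodup_cons]
    simp
    intro _
    grind

def ok (p : F8 × F8) (l : List (F8 × F8)) : Bool := nd (0 :: l.map (slopeN p))

def elems : List F8 := [ofN 0, ofN 1, ofN 2, ofN 3, ofN 4, ofN 5, ofN 6, ofN 7]

def gen : List F8 → List (List (F8 × F8))
  | [] => [[]]
  | x :: xs => (gen xs).flatMap fun l =>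
      (elems.filter fun v => ok (x, v) l).map fun v => (x, v) :: l

theorem gen_length : (gen elems).length = 560 := by decide +kernel

theorem mem_elems : ∀ x : F8, x ∈ elems := by decide +kernel
theorem nodup_elems : elems.Nodup := by decide +kernel

theorem nodup_gen (xs : List F8) : (gen xs).Nodup := by
  induction xs with
  | nil => simp [gen]
  | cons x xs ih =>
    rw [gen, List.nodup_flatMap]
    refine ⟨fun l _ => ?_, ?_⟩
    · refine List.Nodup.map ?_ (nodup_elems.filter _)
      intro a b h
      simpa using h
    · refine List.Pairwise.imp ?_ ih
      intro a b hab
      simp only [Function.onFun]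
      intro c hc hd
      simp only [List.mem_map] at hc hd
      obtain ⟨v, _, rfl⟩ := hc
      obtain ⟨w, _, h⟩ := hd
      simp at h
      exact hab h.2.symm

def lst (f : F8 → F8) (xs : List F8) : List (F8 × F8) := xs.map fun x => (x, f x)

def Good' (f : F8 → F8) (xs : List F8) : Prop :=
  (∀ x ∈ xs, ∀ y ∈ xs, x ≠ y → f x ≠ f y) ∧ ∀ x ∈ xs, ∀ y ∈ xs, ∀ z ∈ xs, x ≠ y → x ≠ z → y ≠ z →
    (y - x) * (f z - f x) ≠ (z - x) * (f y - f x)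

theorem toN_inj : Function.Injective toN := Fin.val_injective

theorem sub_eq' (a b : F8) : a - b = a + b := rfl
theorem two0 (a : F8) : a + a = 0 := by revert a; decide +kernel

theorem slope_eq (x y a b : F8) : slope (x, a) (y, b) = (b - a) / (y - x) := by
  simp only [slope, div_eq_mul_inv, sub_eq']
  rw [add_comm a, add_comm x]

theorem ok_iff (f : F8 → F8) (x : F8) (xs : List F8) (hx : x ∉ xs) (hn : xs.Nodup) :
    ok (x, f x) (lst f xs) = true ↔ (∀ y ∈ xs, f x ≠ f y) ∧
      ∀ y ∈ xs, ∀ z ∈ xs, y ≠ z → (y - x) * (f z - f x) ≠ (z - x) * (f y - f x) := by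
  rw [ok, nd_iff, List.nodup_cons, lst, List.map_map]
  have h1 : (slopeN (x, f x) ∘ fun x => (x, f x)) = fun y => toN ((f y - f x) / (y - x)) := by
    funext y
    simp [slopeN_eq, slope_eq]
  rw [h1]
  have hne : ∀ y ∈ xs, y - x ≠ 0 := fun y hy h => hx (sub_eq_zero.1 h ▸ hy)
  refine and_congr ?_ ?_
  · simp only [List.mem_map, not_exists, not_and]
    refine forall₂_congr fun y hy => ?_
    have : (0 : ℕ) = toN 0 := rfl
    rw [this, toN_inj.eq_iff, div_eq_zero_iff, or_iff_left (hne y hy), sub_eq_zero]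
    exact ne_comm
  · rw [List.nodup_map_iff_inj_on hn]
    refine forall₂_congr fun y hy => forall₂_congr fun z hz => ?_
    rw [toN_inj.eq_iff, div_eq_div_iff (hne y hy) (hne z hz), ← not_imp_not]
    refine imp_congr Iff.rfl (not_congr ?_)
    constructor <;> intro h <;> linear_combination -h

theorem good'_cons (f : F8 → F8) (x : F8) (xs : List F8) (hx : x ∉ xs) (hn : xs.Nodup) :
    Good' f (x :: xs) ↔ ok (x, f x) (lst f xs) = true ∧ Good' f xs := by
  rw [ok_iff f x xs hx hn]
  constructor
  · rintro ⟨h1, h2⟩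
    refine ⟨⟨fun y hy => h1 x (by simp) y (by simp [hy]) (by rintro rfl; exact hx hy),
      fun y hy z hz h => h2 x (by simp) y (by simp [hy]) z (by simp [hz])
        (by rintro rfl; exact hx hy) (by rintro rfl; exact hx hz) h⟩,
      fun y hy z hz => h1 y (by simp [hy]) z (by simp [hz]),
      fun y hy z hz w hw => h2 y (by simp [hy]) z (by simp [hz]) w (by simp [hw])⟩
  · rintro ⟨⟨h1, h2⟩, h3, h4⟩
    constructor
    · intro y hy z hz hyz
      simp only [List.mem_cons] at hy hz
      rcases hy with rfl | hy <;> rcases hz with rfl | hz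
      · exact absurd rfl hyz
      · exact h1 z hz
      · exact (h1 y hy).symm
      · exact h3 y hy z hz hyz
    · intro a ha b hb c hc hab hac hbc
      simp only [List.mem_cons] at ha hb hc
      rcases ha with rfl | ha <;> rcases hb with rfl | hb <;> rcases hc with rfl | hc
      · exact absurd rfl hab
      · exact absurd rfl hab
      · exact absurd rfl hac
      · exact h2 b hb c hc hbc
      · exact absurd rfl hbc
      · intro h
        exact h2 a ha c hc hac (by linear_combination -h)
      · intro h
        exact h2 b hb a ha hab.symm (by linear_combination -h)
      · exact h4 a ha b hb c hc hab hac hbc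

theorem mem_gen (f : F8 → F8) (xs : List F8) (hn : xs.Nodup) :
    lst f xs ∈ gen xs ↔ Good' f xs := by
  induction xs with
  | nil => simp [gen, lst, Good']
  | cons x xs ih =>
    rw [List.nodup_cons] at hn
    rw [good'_cons f x xs hn.1 hn.2, ← ih hn.2, gen]
    simp only [List.mem_flatMap, List.mem_map, List.mem_filter]
    constructor
    · rintro ⟨l, hl, v, ⟨_, h⟩, e⟩
      simp only [lst, List.map_cons, List.cons.injEq, Prod.mk.injEq, true_and] at e
      obtain ⟨rfl, rfl⟩ := e
      exact ⟨h, hl⟩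
    · rintro ⟨h, hl⟩
      exact ⟨_, hl, f x, ⟨mem_elems _, h⟩, rfl⟩

theorem gen_fst (xs : List F8) : ∀ l ∈ gen xs, l.map Prod.fst = xs := by
  induction xs with
  | nil => simp [gen]
  | cons x xs ih =>
    intro l hl
    simp only [gen, List.mem_flatMap, List.mem_map, List.mem_filter] at hl
    obtain ⟨l, hl, v, ⟨_, h⟩, rfl⟩ := hl
    simp [ih l hl]

theorem exists_lst (l : List (F8 × F8)) (h : (l.map Prod.fst).Nodup) :
    ∃ f, l = lst f (l.map Prod.fst) := by
  induction l with
  | nil => exact ⟨id, rfl⟩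
  | cons p l ih =>
    rw [List.map_cons, List.nodup_cons] at h
    obtain ⟨f, hf⟩ := ih h.2
    refine ⟨Function.update f p.1 p.2, ?_⟩
    simp only [lst, List.map_cons, Function.update_self]
    congr 1
    refine hf.trans (List.map_congr_left ?_)
    intro x hx
    rw [Function.update_of_ne]
    rintro rfl
    exact h.1 hx

theorem ncard_good : {f : F8 → F8 | OFun f}.ncard = 560 := by
  have hG : ∀ f, OFun f ↔ Good' f elems := by
    intro f
    simp only [OFun, Good', mem_elems, true_imp_iff]
    refine and_congr ⟨fun h x y hxy e => hxy (h e), fun h x y e => ?_⟩ Iff.rfl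
    by_contra hxy
    exact h x y hxy e
  have hinj : Function.Injective (fun f => lst f elems) := by
    intro f g h
    funext x
    have := List.map_inj_left.1 h x (mem_elems x)
    simpa using this
  rw [← Set.ncard_image_of_injective _ hinj, ← gen_length,
    ← List.toFinset_card_of_nodup (nodup_gen elems), ← Set.ncard_coe_finset]
  congr 1
  ext l
  simp only [Set.mem_image, Set.mem_ofPred_eq, List.coe_toFinset]
  constructor
  · rintro ⟨f, hf, rfl⟩
    exact (mem_gen f _ nodup_elems).2 ((hG f).1 hf)
  · intro hl
    have h1 := gen_fst _ l hl
    obtain ⟨f, hf⟩ := exists_lst l (h1 ▸ nodup_elems)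
    rw [h1] at hf
    refine ⟨f, (hG f).2 ((mem_gen f _ nodup_elems).1 (hf ▸ hl)), hf.symm⟩

end F8

theorem ofun_transfer {K L : Type*} [Field K] [Field L] (φ : K ≃+* L) (f : K → K) (h : OFun f) :
    OFun (fun x => φ (f (φ.symm x))) := by
  refine ⟨φ.injective.comp (h.1.comp φ.symm.injective), fun x y z hxy hxz hyz e => ?_⟩
  refine h.2 (φ.symm x) (φ.symm y) (φ.symm z) (by simpa using hxy) (by simpa using hxz)
    (by simpa using hyz) (φ.injective ?_)
  simpa using e

theorem ncard_ofun {K : Type*} [Field K] (φ : F8 ≃+* K) : {f : K → K | OFun f}.ncard = 560 := by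
  rw [← F8.ncard_good]
  have hinj : Function.Injective (fun (f : F8 → F8) (x : K) => φ (f (φ.symm x))) := by
    intro f g h
    funext x
    simpa using congrFun h (φ x)
  rw [← Set.ncard_image_of_injective _ hinj]
  congr 1
  ext f
  simp only [Set.mem_ofPred_eq, Set.mem_image]
  constructor
  · intro hf
    refine ⟨_, ofun_transfer φ.symm f hf, ?_⟩
    funext x
    simp
  · rintro ⟨g, hg, rfl⟩
    exact ofun_transfer φ g hg

section Geometry

variable {K : Type*} [Field K]

def mkP (u : Fin 3 → K) (hu : u ≠ 0) : PGPoint K 2 :=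
  ⟨span K {u}, finrank_span_singleton hu⟩

theorem exists_mkP (P : PGPoint K 2) : ∃ u hu, P = mkP u hu := by
  obtain ⟨W, hW⟩ := P
  obtain ⟨v, hv, h⟩ := finrank_eq_one_iff'.1 hW
  refine ⟨v, by simpa using hv, Subtype.ext ?_⟩
  refine le_antisymm (fun x hx => ?_) ?_
  · obtain ⟨c, hc⟩ := h ⟨x, hx⟩
    exact mem_span_singleton.2 ⟨c, congrArg Subtype.val hc⟩
  · exact (span_singleton_le_iff_mem _ _).2 v.2

theorem mkP_eq (u v : Fin 3 → K) (hu hv) : mkP u hu = mkP v hv ↔ ∃ c : K, c ≠ 0 ∧ c • u = v := by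
  have h : mkP u hu = mkP v hv ↔ span K {u} = span K {v} :=
    ⟨fun h => congrArg Subtype.val h, fun h => Subtype.ext h⟩
  rw [h, span_singleton_eq_span_singleton]
  constructor
  · rintro ⟨z, hz⟩
    exact ⟨z, z.ne_zero, hz⟩
  · rintro ⟨c, hc, h⟩
    exact ⟨Units.mk0 c hc, h⟩

def Arc (O : Set (PGPoint K 2)) : Prop :=
  ∀ L : Set (PGPoint K 2), IsKSpace 1 L → (O ∩ L).ncard ≤ 2

def Hyp (O : Set (PGPoint K 2)) : Prop := O.ncard = Nat.card K + 2 ∧ Arc O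

instance finPG [Finite K] : Finite (PGPoint K 2) := by
  unfold PGPoint
  infer_instance

theorem arc_det [Finite K] {O : Set (PGPoint K 2)} (hO : Arc O) {u v w : Fin 3 → K} {hu hv hw}
    (hu' : mkP u hu ∈ O) (hv' : mkP v hv ∈ O) (hw' : mkP w hw ∈ O)
    (huv : mkP u hu ≠ mkP v hv) (huw : mkP u hu ≠ mkP w hw) (hvw : mkP v hv ≠ mkP w hw) :
    (Matrix.of ![u, v, w]).det ≠ 0 := by
  intro h
  obtain ⟨a, ha, hM⟩ := Matrix.exists_mulVec_eq_zero_iff.2 h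
  let l : (Fin 3 → K) →ₗ[K] K := dotProductBilin K K a
  have hl : l ≠ 0 := by
    intro h0
    apply ha
    funext i
    have := LinearMap.congr_fun h0 (Pi.single i 1)
    simpa [l] using this
  have hW : Module.finrank K (LinearMap.ker l) = 1 + 1 := by
    have := Module.Dual.finrank_ker_add_one_of_ne_zero (f := l) hl
    simp at this
    omega
  have h2 := hO _ ⟨LinearMap.ker l, hW, rfl⟩
  have hmem : ∀ x : Fin 3 → K, x ⬝ᵥ a = 0 → ∀ hx, mkP x hx ∈ pts (LinearMap.ker l) := by
    intro x hx h0
    refine (span_singleton_le_iff_mem _ _).2 ?_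
    rw [LinearMap.mem_ker]
    show a ⬝ᵥ x = 0
    rwa [dotProduct_comm]
  have h3 : 2 < (O ∩ pts (LinearMap.ker l)).ncard := by
    rw [Set.two_lt_ncard_iff (Set.toFinite _)]
    exact ⟨_, _, _, ⟨hu', hmem u (congrFun hM 0) _⟩, ⟨hv', hmem v (congrFun hM 1) _⟩,
      ⟨hw', hmem w (congrFun hM 2) _⟩, huv, huw, hvw⟩
  omega

theorem arc_range [Finite K] {ι : Type*} (v : ι → Fin 3 → K) (hv : ∀ i, v i ≠ 0)
    (h : ∀ i j k, i ≠ j → i ≠ k → j ≠ k → (Matrix.of ![v i, v j, v k]).det ≠ 0) :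
    Arc (Set.range fun i => mkP (v i) (hv i)) := by
  rintro L ⟨W, hW, rfl⟩
  by_contra! hc
  rw [Set.two_lt_ncard_iff (Set.toFinite _)] at hc
  obtain ⟨P, Q, R, ⟨⟨i, rfl⟩, hi⟩, ⟨⟨j, rfl⟩, hj⟩, ⟨⟨k, rfl⟩, hk⟩, hij, hik, hjk⟩ := hc
  have hd := h i j k (by rintro rfl; exact hij rfl) (by rintro rfl; exact hik rfl)
    (by rintro rfl; exact hjk rfl)
  have hli := Matrix.linearIndependent_rows_of_det_ne_zero hd
  have hf := finrank_span_eq_card hli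
  have hle : span K (Set.range (Matrix.of ![v i, v j, v k]).row) ≤ W := by
    rw [span_le]
    rintro _ ⟨a, rfl⟩
    fin_cases a
    · exact (span_singleton_le_iff_mem _ _).1 hi
    · exact (span_singleton_le_iff_mem _ _).1 hj
    · exact (span_singleton_le_iff_mem _ _).1 hk
  have := Submodule.finrank_mono hle
  have h3 := hf.symm.le.trans (this.trans hW.le)
  simp at h3

def vec (f : K → K) : Option (Option K) → Fin 3 → K
  | none => ![0, 1, 0]
  | some none => ![0, 0, 1]
  | some (some x) => ![1, x, f x]

theorem aff_ne (x y : K) : ![1, x, y] ≠ 0 := fun h => by simpa using congrFun h 0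
theorem a_ne : ![(0 : K), 1, 0] ≠ 0 := fun h => by simpa using congrFun h 1
theorem b_ne : ![(0 : K), 0, 1] ≠ 0 := fun h => by simpa using congrFun h 2

def ptA : PGPoint K 2 := mkP _ a_ne
def ptB : PGPoint K 2 := mkP _ b_ne
def aff (x y : K) : PGPoint K 2 := mkP _ (aff_ne x y)

theorem vec_ne (f : K → K) (i) : vec f i ≠ 0 := by
  rcases i with _ | _ | x
  · exact a_ne
  · exact b_ne
  · exact aff_ne _ _

theorem aff_inj {x y x' y' : K} : aff x y = aff x' y' ↔ x = x' ∧ y = y' := by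
  constructor
  · intro h
    obtain ⟨c, hc, h⟩ := (mkP_eq _ _ _ _).1 h
    have h0 := congrFun h 0
    have h1 := congrFun h 1
    have h2 := congrFun h 2
    simp at h0 h1 h2
    subst h0
    simpa using And.intro h1 h2
  · rintro ⟨rfl, rfl⟩
    rfl

theorem aff_ne_A {x y : K} : aff x y ≠ ptA := by
  intro h
  obtain ⟨c, hc, h⟩ := (mkP_eq _ _ _ _).1 h
  have h0 := congrFun h 0
  simp at h0
  exact hc h0

theorem aff_ne_B {x y : K} : aff x y ≠ ptB := by
  intro h
  obtain ⟨c, hc, h⟩ := (mkP_eq _ _ _ _).1 h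
  have h0 := congrFun h 0
  simp at h0
  exact hc h0

theorem A_ne_B : (ptA : PGPoint K 2) ≠ ptB := by
  intro h
  obtain ⟨c, hc, h⟩ := (mkP_eq _ _ _ _).1 h
  have h0 := congrFun h 1
  simp at h0
  exact hc h0

def pnt (f : K → K) (i : Option (Option K)) : PGPoint K 2 := mkP (vec f i) (vec_ne f i)

theorem pnt_inj (f : K → K) : Function.Injective (pnt f) := by
  rintro (_ | _ | x) (_ | _ | y) h
  · rfl
  · exact absurd h A_ne_B
  · exact absurd h.symm aff_ne_A
  · exact absurd h.symm A_ne_B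
  · rfl
  · exact absurd h.symm aff_ne_B
  · exact absurd h aff_ne_A
  · exact absurd h aff_ne_B
  · rw [(aff_inj.1 h).1]

theorem ncard_range_pnt [Finite K] (f : K → K) : (Set.range (pnt f)).ncard = Nat.card K + 2 := by
  rw [← Set.image_univ, Set.ncard_image_of_injective _ (pnt_inj f), Set.ncard_univ,
    Finite.card_option, Finite.card_option]

theorem arc_pnt [Finite K] (f : K → K) (h : OFun f) : Arc (Set.range (pnt f)) := by
  obtain ⟨h1, h2⟩ := h
  refine arc_range (vec f) (vec_ne f) ?_
  have h1' : ∀ x y, x ≠ y → f x ≠ f y := fun x y hxy e => hxy (h1 e)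
  rintro (_ | _ | x) (_ | _ | y) (_ | _ | z) hij hik hjk <;>
    simp [vec, Matrix.det_fin_three] at hij hik hjk ⊢
  all_goals grind

theorem surj_pnt [Finite K] (O : Set (PGPoint K 2)) (hO : Hyp O) (hA : ptA ∈ O) (hB : ptB ∈ O) :
    ∃ f, OFun f ∧ Set.range (pnt f) = O := by
  obtain ⟨hc, ha⟩ := hO
  have hcard : (O \ {ptA, ptB}).ncard = Nat.card K := by
    have := Set.ncard_sdiff_add_ncard_of_subset
      (show ({ptA, ptB} : Set (PGPoint K 2)) ⊆ O from by
        rintro x (rfl | rfl) <;> assumption) (Set.toFinite _)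
    rw [Set.ncard_pair A_ne_B] at this
    omega
  let S : Set (K × K) := {p | aff p.1 p.2 ∈ O}
  have himg : O \ {ptA, ptB} = (fun p : K × K => aff p.1 p.2) '' S := by
    ext P
    constructor
    · rintro ⟨hP, hne⟩
      simp only [Set.mem_insert_iff, Set.mem_singleton_iff, not_or] at hne
      obtain ⟨u, hu, rfl⟩ := exists_mkP P
      have hd := arc_det ha hP hA hB hne.1 hne.2 A_ne_B
      simp [Matrix.det_fin_three] at hd
      have he : mkP u hu = aff (u 1 / u 0) (u 2 / u 0) := by
        refine (mkP_eq _ _ _ _).2 ⟨(u 0)⁻¹, inv_ne_zero hd, ?_⟩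
        funext i
        fin_cases i <;> simp [hd, div_eq_inv_mul]
      exact ⟨(u 1 / u 0, u 2 / u 0), by rw [he] at hP; exact hP, he.symm⟩
    · rintro ⟨p, hp, rfl⟩
      exact ⟨hp, by simp [aff_ne_A, aff_ne_B]⟩
  have hinj : Function.Injective (fun p : K × K => aff p.1 p.2) := by
    rintro ⟨a, b⟩ ⟨c, d⟩ h
    have := aff_inj.1 h
    simpa using this
  have hfst : Set.InjOn Prod.fst S := by
    rintro ⟨x, y⟩ hp ⟨x', z⟩ hq h
    simp only at h
    subst h
    by_contra hne
    refine arc_det ha hp hq hB (hinj.ne hne) aff_ne_B aff_ne_B ?_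
    simp [Matrix.det_fin_three]
  have huniv : Prod.fst '' S = Set.univ := by
    refine Set.eq_of_subset_of_ncard_le (Set.subset_univ _) ?_ (Set.toFinite _)
    rw [hfst.ncard_image, ← Set.ncard_image_of_injective S hinj, ← himg, hcard,
      Set.ncard_univ]
  have hex : ∀ x, ∃ y, aff x y ∈ O := by
    intro x
    obtain ⟨⟨x', y⟩, hp, rfl⟩ := (huniv.symm ▸ Set.mem_univ x : x ∈ Prod.fst '' S)
    exact ⟨y, hp⟩
  choose f hf using hex
  refine ⟨f, ⟨?_, ?_⟩, ?_⟩
  · intro x y hxy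
    by_contra hne
    refine arc_det ha (hf x) (hf y) hA (fun h => hne (aff_inj.1 h).1) aff_ne_A aff_ne_A ?_
    simp [Matrix.det_fin_three, hxy]
  · intro x y z hxy hxz hyz e
    refine arc_det ha (hf x) (hf y) (hf z) (fun h => hxy (aff_inj.1 h).1)
      (fun h => hxz (aff_inj.1 h).1) (fun h => hyz (aff_inj.1 h).1) ?_
    simp [Matrix.det_fin_three]
    linear_combination e
  · refine Set.eq_of_subset_of_ncard_le ?_ ?_ (Set.toFinite _)
    · rintro _ ⟨_ | _ | x, rfl⟩
      · exact hA
      · exact hB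
      · exact hf x
    · rw [ncard_range_pnt, hc]

theorem range_pnt_inj : Function.Injective fun f : K → K => Set.range (pnt f) := by
  intro f g h
  funext x
  have : aff x (f x) ∈ Set.range (pnt g) := by
    rw [← show Set.range (pnt f) = Set.range (pnt g) from h]
    exact ⟨some (some x), rfl⟩
  obtain ⟨_ | _ | y, hy⟩ := this
  · exact absurd hy.symm aff_ne_A
  · exact absurd hy.symm aff_ne_B
  · obtain ⟨rfl, h⟩ := aff_inj.1 hy
    exact h.symm

theorem ncard_AB [Finite K] (φ : F8 ≃+* K) :
    {O : Set (PGPoint K 2) | Hyp O ∧ ptA ∈ O ∧ ptB ∈ O}.ncard = 560 := by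
  rw [← ncard_ofun φ, ← Set.ncard_image_of_injective _ range_pnt_inj]
  congr 1
  ext O
  simp only [Set.mem_ofPred_eq, Set.mem_image]
  constructor
  · rintro ⟨h, hA, hB⟩
    exact surj_pnt O h hA hB
  · rintro ⟨f, hf, rfl⟩
    exact ⟨⟨ncard_range_pnt f, arc_pnt f hf⟩, ⟨none, rfl⟩, ⟨some none, rfl⟩⟩

/-- action of a linear automorphism on points -/
def act (g : (Fin 3 → K) ≃ₗ[K] (Fin 3 → K)) : PGPoint K 2 ≃ PGPoint K 2 where
  toFun P := ⟨P.1.map (g : (Fin 3 → K) →ₗ[K] (Fin 3 → K)), (g.finrank_map_eq P.1).trans P.2⟩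
  invFun P := ⟨P.1.map (g.symm : (Fin 3 → K) →ₗ[K] (Fin 3 → K)),
    (g.symm.finrank_map_eq P.1).trans P.2⟩
  left_inv P := Subtype.ext (by simp [← Submodule.map_comp])
  right_inv P := Subtype.ext (by simp [← Submodule.map_comp])

theorem act_mkP (g : (Fin 3 → K) ≃ₗ[K] (Fin 3 → K)) (u v : Fin 3 → K) (hu hv) (h : g u = v) :
    act g (mkP u hu) = mkP v hv := by
  subst h
  refine Subtype.ext ?_
  show Submodule.map (g : (Fin 3 → K) →ₗ[K] (Fin 3 → K)) (span K {u}) = span K {g u}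
  rw [Submodule.map_span, Set.image_singleton]
  rfl

theorem arc_act (g : (Fin 3 → K) ≃ₗ[K] (Fin 3 → K)) (O : Set (PGPoint K 2)) (h : Arc O) :
    Arc (act g '' O) := by
  rintro L ⟨W, hW, rfl⟩
  have := h _ ⟨W.map (g.symm : (Fin 3 → K) →ₗ[K] (Fin 3 → K)),
    (g.symm.finrank_map_eq W).trans hW, rfl⟩
  rw [← Set.ncard_image_of_injective _ (act g).injective] at this
  convert this using 2
  ext P
  constructor
  · rintro ⟨⟨Q, hQ, rfl⟩, hP⟩
    refine ⟨Q, ⟨hQ, ?_⟩, rfl⟩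
    have := Submodule.map_mono (f := (g.symm : (Fin 3 → K) →ₗ[K] (Fin 3 → K))) hP
    have h2 := congrArg Subtype.val ((act g).left_inv Q)
    exact h2.symm.le.trans this
  · rintro ⟨Q, ⟨hQ, hP⟩, rfl⟩
    refine ⟨⟨Q, hQ, rfl⟩, ?_⟩
    have := Submodule.map_mono (f := (g : (Fin 3 → K) →ₗ[K] (Fin 3 → K))) hP
    refine le_trans this ?_
    simp [← Submodule.map_comp]

theorem hyp_act (g : (Fin 3 → K) ≃ₗ[K] (Fin 3 → K)) (O : Set (PGPoint K 2)) (h : Hyp O) :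
    Hyp (act g '' O) :=
  ⟨by rw [Set.ncard_image_of_injective _ (act g).injective, h.1], arc_act g O h.2⟩

theorem act_symm (g : (Fin 3 → K) ≃ₗ[K] (Fin 3 → K)) : act g.symm = (act g).symm := rfl

theorem exists_act (P Q : PGPoint K 2) (h : P ≠ Q) :
    ∃ g : (Fin 3 → K) ≃ₗ[K] (Fin 3 → K), act g ptA = P ∧ act g ptB = Q := by
  obtain ⟨u, hu, rfl⟩ := exists_mkP P
  obtain ⟨v, hv, rfl⟩ := exists_mkP Q
  have hli : LinearIndependent K ![u, v] := by
    rw [LinearIndependent.pair_iff' hu]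
    intro a ha
    refine h ((mkP_eq _ _ _ _).2 ⟨a, ?_, ha⟩)
    rintro rfl
    exact hv (by simpa using ha.symm)
  have hc := crossProduct_ne_zero_iff_linearIndependent.2 hli
  obtain ⟨i, hi⟩ := Function.ne_iff.1 hc
  have hd : (Matrix.of ![Pi.single i 1, u, v]).det ≠ 0 := by
    have hi : crossProduct u v i ≠ (0 : K) := hi
    convert hi using 1
    rw [cross_apply]
    fin_cases i <;> simp [Matrix.det_fin_three] <;> ring
  have hl := Matrix.linearIndependent_rows_of_det_ne_zero hd
  let b := basisOfLinearIndependentOfCardEqFinrank hl (by simp)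
  let g := (Pi.basisFun K (Fin 3)).equiv b (Equiv.refl _)
  have hg : ∀ j, g (Pi.single j 1) = Matrix.of ![Pi.single i 1, u, v] j := by
    intro j
    have := (Pi.basisFun K (Fin 3)).equiv_apply j b (Equiv.refl _)
    rw [Pi.basisFun_apply] at this
    refine this.trans ?_
    simp [b]
  refine ⟨g, act_mkP _ _ _ _ _ ?_, act_mkP _ _ _ _ _ ?_⟩
  · refine Eq.trans (congrArg g ?_) (hg 1)
    funext j
    fin_cases j <;> simp
  · refine Eq.trans (congrArg g ?_) (hg 2)
    funext j
    fin_cases j <;> simp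

theorem ncard_PQ [Finite K] (φ : F8 ≃+* K) (P Q : PGPoint K 2) (h : P ≠ Q) :
    {O : Set (PGPoint K 2) | Hyp O ∧ P ∈ O ∧ Q ∈ O}.ncard = 560 := by
  obtain ⟨g, rfl, rfl⟩ := exists_act P Q h
  rw [← ncard_AB φ, ← Set.ncard_image_of_injective
    {O : Set (PGPoint K 2) | Hyp O ∧ ptA ∈ O ∧ ptB ∈ O} (act g).injective.image_injective]
  congr 1
  ext O
  simp only [Set.mem_ofPred_eq, Set.mem_image]
  constructor
  · rintro ⟨h, hA, hB⟩
    refine ⟨act g.symm '' O, ⟨hyp_act _ _ h, ⟨_, hA, ?_⟩, ⟨_, hB, ?_⟩⟩, ?_⟩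
    · simp [act_symm]
    · simp [act_symm]
    · simp [act_symm, Set.image_image]
  · rintro ⟨O, ⟨h, hA, hB⟩, rfl⟩
    exact ⟨hyp_act _ _ h, ⟨_, hA, rfl⟩, ⟨_, hB, rfl⟩⟩

theorem card_pts [Finite K] (h8 : Nat.card K = 8) : Nat.card (PGPoint K 2) = 73 := by
  have h1 := Nat.card_congr (Projectivization.equivSubmodule K (Fin 3 → K))
  have h2 := Projectivization.card'' K (Fin 3 → K)
  rw [Nat.card_fun, h8] at h2
  norm_num at h2
  exact h1.symm.trans h2

open Classical in
theorem ncard_hyp [Finite K] (φ : F8 ≃+* K) (h8 : Nat.card K = 8) :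
    {O : Set (PGPoint K 2) | Hyp O}.ncard = 32704 := by
  have : Fintype (PGPoint K 2) := Fintype.ofFinite _
  have hX : Fintype.card (PGPoint K 2) = 73 := by rw [← Nat.card_eq_fintype_card, card_pts h8]
  let s : Finset (Set (PGPoint K 2)) := Finset.univ.filter Hyp
  let t : Finset (PGPoint K 2 × PGPoint K 2) := Finset.univ.offDiag
  have key := Finset.card_mul_eq_card_mul (s := s) (t := t)
    (fun O p => p.1 ∈ O ∧ p.2 ∈ O) (m := 90) (n := 560) ?_ ?_
  · have ht : t.card = 73 * 72 := by
      simp [t, Finset.offDiag_card, hX]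
    have hs : {O : Set (PGPoint K 2) | Hyp O}.ncard = s.card := by
      rw [← Set.ncard_coe_finset]
      congr 1
      ext O
      simp [s]
    rw [ht] at key
    omega
  · intro O hO
    have hO : Hyp O := by simpa [s] using hO
    have hc : O.toFinset.card = 10 := by
      rw [← Set.ncard_eq_toFinset_card', hO.1, h8]
    have : t.bipartiteAbove (fun O p => p.1 ∈ O ∧ p.2 ∈ O) O = O.toFinset.offDiag := by
      ext p
      simp [t, Finset.bipartiteAbove]
      tauto
    rw [this, Finset.offDiag_card, hc]
  · rintro ⟨P, Q⟩ hp
    have hp : P ≠ Q := by simpa [t] using hp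
    rw [← ncard_PQ φ P Q hp, ← Set.ncard_coe_finset]
    congr 1
    ext O
    simp [s, Finset.bipartiteBelow]

end Geometry

/-- The number of hyperovals in `PG(2,8)` (sets of `q + 2`
points, no three collinear, where `q = 8`) is exactly `32704`.  (`PG(2,8)` is
built over the field `GaloisField 2 3` of `8` elements.) -/
theorem stmt16 :
    {O : Set (PGPoint (GaloisField 2 3) 2) |
      O.ncard = Nat.card (GaloisField 2 3) + 2 ∧
      ∀ L : Set (PGPoint (GaloisField 2 3) 2), IsKSpace 1 L →
        (O ∩ L).ncard ≤ 2}.ncard = 32704 := by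
  have h8 : Nat.card (GaloisField 2 3) = 8 := by
    rw [GaloisField.card 2 3 (by norm_num)]
    norm_num
  have : Fintype (GaloisField 2 3) := Fintype.ofFinite _
  have hF : Fintype.card F8 = Fintype.card (GaloisField 2 3) := by
    rw [← Nat.card_eq_fintype_card (α := GaloisField 2 3), h8]
    rfl
  exact ncard_hyp (FiniteField.ringEquivOfCardEq hF) h8
end

section
/- Let q be an even prime power, let n ≥ 4, and let S be a set of even type of size (q+2)q^{n−2} in PG(n,q). Then there exists a plane π of PG(n,q) with |S ∩ π| = q+2; since S ∩ π is a set of even type in π, S ∩ π is a hyperoval of π. -/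
open Submodule

instance instFinitePG {K : Type*} [Field K] [Finite K] {n : ℕ} : Finite (PGPoint K n) := by
  unfold PGPoint
  infer_instance

lemma le_of_two_points {K : Type*} [Field K] {n : ℕ} {P R : PGPoint K n} (hPR : P ≠ R)
    {L V : Submodule K (Fin (n + 1) → K)} (hL : Module.finrank K L = 2)
    (hP : P.1 ≤ L) (hR : R.1 ≤ L) (hP' : P.1 ≤ V) (hR' : R.1 ≤ V) : L ≤ V := by
  have h1 : P.1 < P.1 ⊔ R.1 := by
    refine lt_of_le_of_ne le_sup_left fun h => hPR ?_
    have : R.1 ≤ P.1 := by rw [h]; exact le_sup_right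
    exact Subtype.ext (Submodule.eq_of_le_of_finrank_eq this (by rw [P.2, R.2])).symm
  have h2 := Submodule.finrank_lt_finrank_of_lt h1
  rw [P.2] at h2
  have h3 : P.1 ⊔ R.1 = L :=
    Submodule.eq_of_le_of_finrank_le (sup_le hP hR) (by omega)
  rw [← h3]
  exact sup_le hP' hR'

lemma eq_of_mem {K : Type*} [Field K] {n : ℕ} {Q : PGPoint K n}
    {U X Y : Submodule K (Fin (n + 1) → K)}
    (hX : U ≤ X) (hY : U ≤ Y) (hX' : Module.finrank K X = Module.finrank K U + 1)
    (hY' : Module.finrank K Y = Module.finrank K U + 1)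
    (hQ : ¬ Q.1 ≤ U) (hQX : Q.1 ≤ X) (hQY : Q.1 ≤ Y) : X = Y := by
  have h1 : U < U ⊔ Q.1 := by
    refine lt_of_le_of_ne le_sup_left fun h => hQ ?_
    rw [h]; exact le_sup_right
  have h2 := Submodule.finrank_lt_finrank_of_lt h1
  have h3 : U ⊔ Q.1 = X := Submodule.eq_of_le_of_finrank_le (sup_le hX hQX) (by omega)
  have h4 : U ⊔ Q.1 = Y := Submodule.eq_of_le_of_finrank_le (sup_le hY hQY) (by omega)
  rw [← h3, h4]

lemma finrank_comap_mkQ {K E : Type*} [Field K] [AddCommGroup E] [Module K E]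
    [FiniteDimensional K E] (U : Submodule K E) (W : Submodule K (E ⧸ U)) :
    Module.finrank K (W.comap U.mkQ) = Module.finrank K W + Module.finrank K U := by
  have hU : U ≤ W.comap U.mkQ := by
    intro x hx
    simp [(Submodule.Quotient.mk_eq_zero U).2 hx]
  have h := LinearMap.finrank_range_add_finrank_ker (U.mkQ.domRestrict (W.comap U.mkQ))
  rw [LinearMap.range_domRestrict, Submodule.map_comap_eq_of_surjective U.mkQ_surjective,
    LinearMap.ker_domRestrict, U.ker_mkQ] at h
  rw [← h]
  congr 1
  exact (Submodule.comapSubtypeEquivOfLe hU).finrank_eq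

lemma card_between {K E : Type*} [Field K] [Finite K] [AddCommGroup E] [Module K E]
    [FiniteDimensional K E] (U V : Submodule K E) (hUV : U ≤ V) (k : ℕ)
    (hk : Module.finrank K V = Module.finrank K U + k) :
    ∑ i ∈ Finset.range k, Nat.card K ^ i ≤
      {X : Submodule K E | U ≤ X ∧ X ≤ V ∧
        Module.finrank K X = Module.finrank K U + 1}.ncard := by
  have : Finite E := Module.finite_of_finite K
  set V' := V.map U.mkQ with hV'
  have hc : V'.comap U.mkQ = V := by
    rw [hV', Submodule.comap_map_mkQ, sup_eq_right.2 hUV]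
  have hd : Module.finrank K V' = k := by
    have := finrank_comap_mkQ U V'
    rw [hc] at this; omega
  rw [← Projectivization.card_of_finrank K V' hd, ← Nat.card_coe_set_eq]
  have hf : ∀ x : Projectivization K V', ((x.submodule.map V'.subtype).comap U.mkQ) ∈
      {X : Submodule K E | U ≤ X ∧ X ≤ V ∧ Module.finrank K X = Module.finrank K U + 1} := by
    intro x
    refine ⟨?_, ?_, ?_⟩
    · intro y hy
      rw [Submodule.mem_comap, Submodule.mkQ_apply, (Submodule.Quotient.mk_eq_zero U).2 hy]
      exact Submodule.zero_mem _
    · conv_rhs => rw [← hc]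
      exact Submodule.comap_mono (Submodule.map_subtype_le _ _)
    · rw [finrank_comap_mkQ, Submodule.finrank_map_subtype_eq, x.finrank_submodule, add_comm]
  refine Nat.card_le_card_of_injective (fun x => ⟨_, hf x⟩) ?_
  intro x y h
  have h := congrArg Subtype.val h
  have h1 := Submodule.comap_injective_of_surjective U.mkQ_surjective h
  have h2 := Submodule.map_injective_of_injective V'.injective_subtype h1
  exact Projectivization.submodule_injective h2

lemma count_between {K : Type*} [Field K] [Finite K] {n : ℕ} (S : Set (PGPoint K n))
    (U V : Submodule K (Fin (n + 1) → K)) (hUV : U ≤ V) (k m : ℕ)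
    (hk : Module.finrank K V = Module.finrank K U + k)
    (h : ∀ X : Submodule K (Fin (n + 1) → K), U ≤ X → X ≤ V →
      Module.finrank K X = Module.finrank K U + 1 → m ≤ ((S ∩ pts X) \ pts U).ncard) :
    (∑ i ∈ Finset.range k, Nat.card K ^ i) * m ≤ ((S ∩ pts V) \ pts U).ncard := by
  classical
  have : Fintype (PGPoint K n) := Fintype.ofFinite _
  refine (Nat.mul_le_mul_right m (card_between U V hUV k hk)).trans ?_
  set A := {X : Submodule K (Fin (n + 1) → K) | U ≤ X ∧ X ≤ V ∧
        Module.finrank K X = Module.finrank K U + 1} with hA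
  have : Fintype A := Fintype.ofFinite _
  have hdis : Set.PairwiseDisjoint (A.toFinset : Set (Submodule K (Fin (n + 1) → K)))
      (fun X => ((S ∩ pts X) \ pts U).toFinset) := by
    intro X hX Y hY hXY
    rw [Function.onFun, Set.disjoint_toFinset, Set.disjoint_left]
    intro Q hQ hQ'
    simp only [Set.coe_toFinset] at hX hY
    exact hXY (eq_of_mem hX.1 hY.1 hX.2.2 hY.2.2 hQ.2 hQ.1.2 hQ'.1.2)
  rw [Set.ncard_eq_toFinset_card' A, Set.ncard_eq_toFinset_card' ((S ∩ pts V) \ pts U)]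
  have h1 : A.toFinset.card * m ≤ ∑ X ∈ A.toFinset, ((S ∩ pts X) \ pts U).toFinset.card := by
    rw [← smul_eq_mul]
    refine Finset.card_nsmul_le_sum _ _ _ fun X hX => ?_
    rw [Set.mem_toFinset] at hX
    rw [← Set.ncard_eq_toFinset_card']
    exact h X hX.1 hX.2.1 hX.2.2
  refine h1.trans ?_
  rw [← Finset.card_biUnion hdis]
  refine Finset.card_le_card ?_
  intro Q hQ
  simp only [Finset.mem_biUnion, Set.mem_toFinset] at hQ ⊢
  obtain ⟨X, hX, hQ⟩ := hQ
  exact ⟨⟨hQ.1.1, hQ.1.2.trans hX.2.1⟩, hQ.2⟩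

lemma pts_point {K : Type*} [Field K] {n : ℕ} (P : PGPoint K n) : pts P.1 = {P} := by
  ext Q
  simp only [pts, Set.mem_ofPred_eq, Set.mem_singleton_iff]
  constructor
  · intro h
    exact Subtype.ext (Submodule.eq_of_le_of_finrank_eq h (by rw [P.2, Q.2]))
  · rintro rfl; exact le_rfl

/-- A line through a point of `S` has exactly one or at least three further points of `S`. -/
lemma line_count {K : Type*} [Field K] [Finite K] {n : ℕ} {S : Set (PGPoint K n)}
    (hS : IsEvenType S) {P : PGPoint K n} (hP : P ∈ S) {X : Submodule K (Fin (n + 1) → K)}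
    (hX : Module.finrank K X = 2) (hPX : P.1 ≤ X) :
    Odd ((S ∩ pts X) \ {P}).ncard ∧ ((S ∩ pts X) \ {P}).ncard + 1 = (S ∩ pts X).ncard := by
  have h1 : Even (S ∩ pts X).ncard := hS _ ⟨X, hX, rfl⟩
  have h2 : ((S ∩ pts X) \ {P}).ncard + 1 = (S ∩ pts X).ncard :=
    Set.ncard_sdiff_singleton_add_one (⟨hP, hPX⟩ : P ∈ S ∩ pts X)
  refine ⟨?_, h2⟩
  rw [← h2] at h1
  grind

lemma plane_ge {K : Type*} [Field K] [Finite K] {n : ℕ} {S : Set (PGPoint K n)}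
    (hS : IsEvenType S) {P : PGPoint K n} (hP : P ∈ S) {W : Submodule K (Fin (n + 1) → K)}
    (hW : Module.finrank K W = 3) (hPW : P.1 ≤ W) :
    Nat.card K + 2 ≤ (S ∩ pts W).ncard := by
  have h := count_between S P.1 W hPW 2 1 (by rw [hW, P.2]) (by
    intro X h1 _ h3
    rw [P.2] at h3
    rw [pts_point]
    exact (line_count hS hP h3 h1).1.pos)
  rw [pts_point] at h
  have h2 : ((S ∩ pts W) \ {P}).ncard + 1 = (S ∩ pts W).ncard :=
    Set.ncard_sdiff_singleton_add_one (⟨hP, hPW⟩ : P ∈ S ∩ pts W)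
  simp [Finset.sum_range_succ] at h
  omega

lemma hyperoval_of_card {K : Type*} [Field K] [Finite K] {n : ℕ} {S : Set (PGPoint K n)}
    (hS : IsEvenType S) {W : Submodule K (Fin (n + 1) → K)}
    (hW : Module.finrank K W = 3) (hc : (S ∩ pts W).ncard = Nat.card K + 2) :
    IsHyperovalIn (pts W) (S ∩ pts W) := by
  refine ⟨Set.inter_subset_right, hc, ?_⟩
  rintro _ ⟨M, hM, rfl⟩
  by_contra! hgt
  obtain ⟨P, hP, R, hR, T, hT, hPR, hPT, hRT⟩ := (Set.two_lt_ncard).1 hgt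
  have h := count_between (S \ {R}) P.1 W hP.1.2 2 1 (by rw [hW, P.2]) (by
    intro X h1 _ h3
    rw [P.2] at h3
    rw [pts_point, Nat.one_le_iff_ne_zero, ← Nat.pos_iff_ne_zero, Set.ncard_pos]
    by_cases hRX : R.1 ≤ X
    · have hMX : M ≤ X := le_of_two_points hPR hM hP.2 hR.2 h1 hRX
      exact ⟨T, ⟨⟨hT.1.1, hRT.symm⟩, hT.2.trans hMX⟩, hPT.symm⟩
    · obtain ⟨Q, hQ⟩ := (Set.ncard_pos).1 (line_count hS hP.1.1 h3 h1).1.pos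
      refine ⟨Q, ⟨⟨hQ.1.1, ?_⟩, hQ.1.2⟩, hQ.2⟩
      rintro rfl
      exact hRX hQ.1.2)
  rw [pts_point] at h
  have h2 : ((S ∩ pts W) \ {R}).ncard + 1 = (S ∩ pts W).ncard :=
    Set.ncard_sdiff_singleton_add_one hR.1
  have h3 : (((S ∩ pts W) \ {R}) \ {P}).ncard + 1 = ((S ∩ pts W) \ {R}).ncard :=
    Set.ncard_sdiff_singleton_add_one (⟨hP.1, hPR⟩ : P ∈ (S ∩ pts W) \ {R})
  have h4 : ((S \ {R}) ∩ pts W) \ {P} = ((S ∩ pts W) \ {R}) \ {P} := by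
    ext; simp; tauto
  rw [h4] at h
  simp [Finset.sum_range_succ] at h
  omega

/-- Let `q` be an even prime power, `n ≥ 4`, and `S` a set of
even type of size `(q+2)q^{n-2}` in `PG(n,q)`.  Then there is a plane `π` with
`|S ∩ π| = q + 2`; moreover `S ∩ π` is a hyperoval of `π`. -/
theorem stmt17 {K : Type*} [Field K] [Finite K] (hq : Even (Nat.card K))
    (n : ℕ) (hn : 4 ≤ n) (S : Set (PGPoint K n)) (hS : IsEvenType S)
    (hcard : S.ncard = (Nat.card K + 2) * Nat.card K ^ (n - 2)) :
    ∃ π : Set (PGPoint K n), IsKSpace 2 π ∧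
      (S ∩ π).ncard = Nat.card K + 2 ∧ IsHyperovalIn π (S ∩ π) := by
  have hq2 : 2 ≤ Nat.card K := Finite.one_lt_card
  set q := Nat.card K with hqdef
  have htop : pts (⊤ : Submodule K (Fin (n + 1) → K)) = Set.univ := by
    ext; simp [pts]
  have hfr : Module.finrank K (⊤ : Submodule K (Fin (n + 1) → K)) = n + 1 := by simp
  obtain ⟨m, rfl⟩ : ∃ m, n = m + 3 := ⟨n - 3, by omega⟩
  have hqm : 0 < q ^ m := by positivity
  have hm1 : m + 3 - 2 = m + 1 := by omega
  rw [hm1] at hcard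
  have hpos : 0 < S.ncard := by rw [hcard]; positivity
  obtain ⟨P, hP⟩ := (Set.ncard_pos).1 hpos
  -- a line meeting `S` in exactly two points
  obtain ⟨L, hPL, hL, hL2⟩ : ∃ L : Submodule K (Fin (m + 3 + 1) → K), P.1 ≤ L ∧
      Module.finrank K L = 2 ∧ (S ∩ pts L).ncard = 2 := by
    by_contra! hno
    have h := count_between S P.1 ⊤ le_top (m + 3) 3 (by rw [hfr, P.2]; omega) (by
      intro X h1 _ h3
      rw [P.2] at h3
      have h4 := hno X h1 h3
      obtain ⟨h5, h6⟩ := line_count hS hP h3 h1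
      rw [pts_point]
      grind)
    rw [pts_point, htop, Set.inter_univ, Finset.sum_range_succ] at h
    have h2 : (S \ {P}).ncard + 1 = S.ncard := Set.ncard_sdiff_singleton_add_one hP
    rw [hcard] at h2
    rw [← hqdef] at h
    have e1 : q ^ (m + 2) = q * q * q ^ m := by ring
    have e2 : (q + 2) * q ^ (m + 1) = (q * q + 2 * q) * q ^ m := by ring
    rw [e2] at h2
    rw [e1] at h
    have : (q * q + 2 * q) * q ^ m ≤ (q * q * 3) * q ^ m :=
      Nat.mul_le_mul_right _ (by nlinarith)
    have e3 : q * q * 3 * q ^ m = q * q * q ^ m * 3 := by ring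
    rw [e3] at this
    omega
  by_contra! hno
  have h := count_between S L ⊤ le_top (m + 2) (q + 1) (by rw [hfr, hL]; omega) (by
    intro X h1 _ h3
    rw [hL] at h3
    have h4 := plane_ge hS hP h3 (hPL.trans h1)
    have h5 : (S ∩ pts X).ncard ≠ q + 2 := fun h5 =>
      hno (pts X) ⟨X, h3, rfl⟩ h5 (hyperoval_of_card hS h3 h5)
    have h6 : (S ∩ pts X) \ pts L = (S ∩ pts X) \ (S ∩ pts L) := by
      ext; simp; tauto
    have h7 := Set.ncard_sdiff_add_ncard_of_subset
      (show S ∩ pts L ⊆ S ∩ pts X from fun Q hQ => ⟨hQ.1, hQ.2.trans h1⟩)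
    rw [h6]
    omega)
  rw [htop, Set.inter_univ, Finset.sum_range_succ, Finset.sum_range_succ, ← hqdef] at h
  have h2 : (S \ pts L).ncard ≤ S.ncard := Set.ncard_le_ncard Set.sdiff_subset
  rw [hcard] at h2
  have e2 : (q + 2) * q ^ (m + 1) = (q * q + 2 * q) * q ^ m := by ring
  have e1 : (∑ x ∈ Finset.range m, q ^ x + q ^ m + q ^ (m + 1)) * (q + 1) =
    (∑ x ∈ Finset.range m, q ^ x) * (q + 1) + (q * q + 2 * q) * q ^ m + q ^ m := by ring
  rw [e1] at h
  rw [e2] at h2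
  have := Nat.zero_le ((∑ x ∈ Finset.range m, q ^ x) * (q + 1))
  omega
end
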